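/- Let $M>0$ and $0\le b\le t$. Then $\frac{1}{M}\sinh(M(t-b)) = \int_{-(e^{-b}-e^{-t})}^{e^{-b}-e^{-t}} (4e^{-b-t})^{-M}\big((e^{-t}+e^{-b})^2-z^2\big)^{-\frac12+M} F\Big(\tfrac12-M,\tfrac12-M;1;\frac{(e^{-b}-e^{-t})^2-z^2}{(e^{-b}+e^{-t})^2-z^2}\Big)\,dz$, where $F(a,b;c;\zeta)$ denotes Gauss's hypergeometric function. -/

import Mathlib

open Real

/-- Gauss's hypergeometric function `F(a,b;c;z)` (real, defined by its series). -/
noncomputable def gaussHypergeometric (a b c z : ℝ) : ℝ :=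
  ∑' n : ℕ, ((ascPochhammer ℝ n).eval a * (ascPochhammer ℝ n).eval b /
      ((ascPochhammer ℝ n).eval c * (n.factorial : ℝ))) * z ^ n

open Set Filter Topology MeasureTheory Interval

/-- The coefficients of a power series whose radius of convergence is at least one. -/
def SummableOnUnitDisc (A : ℕ → ℝ) : Prop :=
  ∀ r : ℝ, 0 ≤ r → r < 1 → Summable fun n => |A n| * r ^ n

/-- The coefficients of the formal derivative of a power series. -/
def derivCoeff (A : ℕ → ℝ) (n : ℕ) : ℝ := (n + 1) * A (n + 1)

theorem SummableOnUnitDisc.summable {A : ℕ → ℝ} (hA : SummableOnUnitDisc A) {x : ℝ}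
    (hx : |x| < 1) : Summable fun n => A n * x ^ n := by
  refine Summable.of_norm ?_
  simpa [abs_mul, abs_pow] using hA |x| (abs_nonneg x) hx

theorem SummableOnUnitDisc.derivCoeff {A : ℕ → ℝ} (hA : SummableOnUnitDisc A) :
    SummableOnUnitDisc (derivCoeff A) := by
  intro r hr0 hr1
  obtain ⟨s, hrs, hs1⟩ := exists_between hr1
  have hs0 : 0 < s := hr0.trans_lt hrs
  have hq : |r / s| < 1 := by
    rw [abs_of_nonneg (by positivity), div_lt_one hs0]
    exact hrs
  have hlim := tendsto_self_mul_const_pow_of_abs_lt_one hq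
  have hlim' := hlim.add (tendsto_pow_atTop_nhds_zero_of_abs_lt_one hq)
  have hev : ∀ᶠ n : ℕ in atTop, (n : ℝ) * (r / s) ^ n + (r / s) ^ n < 1 :=
    hlim'.eventually (gt_mem_nhds (by norm_num))
  have hsum : Summable fun n => |A (n + 1)| * s ^ n := by
    have := ((summable_nat_add_iff 1).mpr (hA s hs0.le hs1)).mul_left s⁻¹
    refine this.congr fun n => ?_
    rw [pow_succ]
    field_simp
  refine hsum.of_norm_bounded_eventually_nat ?_
  filter_upwards [hev] with n hn
  have h1 : ((n : ℝ) + 1) * r ^ n ≤ s ^ n := by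
    have : ((n : ℝ) + 1) * r ^ n = ((n : ℝ) * (r / s) ^ n + (r / s) ^ n) * s ^ n := by
      rw [div_pow]
      field_simp
    rw [this]
    exact mul_le_of_le_one_left (by positivity) hn.le
  have h2 : ‖|_root_.derivCoeff A n| * r ^ n‖ = |A (n + 1)| * (((n : ℝ) + 1) * r ^ n) := by
    rw [Real.norm_of_nonneg (by positivity), _root_.derivCoeff, abs_mul,
      abs_of_nonneg (by positivity : (0 : ℝ) ≤ n + 1)]
    ring
  rw [h2]
  exact mul_le_mul_of_nonneg_left h1 (abs_nonneg _)

theorem SummableOnUnitDisc.hasDerivAt_tsum {A : ℕ → ℝ} (hA : SummableOnUnitDisc A) {x : ℝ}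
    (hx : |x| < 1) :
    HasDerivAt (fun y => ∑' n, A n * y ^ n) (∑' n, _root_.derivCoeff A n * x ^ n) x := by
  obtain ⟨r, hxr, hr1⟩ := exists_between hx
  have hr0 : 0 < r := (abs_nonneg x).trans_lt hxr
  have hu : Summable fun n => |A n| * (n * r ^ (n - 1)) := by
    rw [← summable_nat_add_iff 1]
    refine (hA.derivCoeff r hr0.le hr1).congr fun n => ?_
    rw [_root_.derivCoeff, abs_mul, abs_of_nonneg (by positivity : (0 : ℝ) ≤ n + 1)]
    push_cast
    ring
  have hx' : x ∈ Ioo (-r) r := abs_lt.mp hxr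
  have key := hasDerivAt_tsum_of_isPreconnected (𝕜 := ℝ) (g := fun n y => A n * y ^ n)
    (g' := fun n y => A n * (n * y ^ (n - 1))) (t := Ioo (-r) r) (y₀ := x) (y := x) hu isOpen_Ioo
    isPreconnected_Ioo (fun n y _ => (hasDerivAt_pow n y).const_mul (A n))
    (fun n y hy => by
      rw [norm_mul, norm_mul, norm_pow, Real.norm_natCast, Real.norm_eq_abs, Real.norm_eq_abs]
      have : |y| ≤ r := (abs_lt.mpr hy).le
      gcongr)
    hx' (hA.summable hx) hx'
  refine key.congr_deriv ?_
  have hs : Summable fun n => A n * (n * x ^ (n - 1)) := by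
    refine hu.of_norm_bounded fun n => ?_
    rw [norm_mul, norm_mul, norm_pow, Real.norm_natCast, Real.norm_eq_abs, Real.norm_eq_abs]
    gcongr
  rw [hs.tsum_eq_zero_add]
  simp only [Nat.cast_zero, zero_mul, mul_zero, zero_add, Nat.add_sub_cancel]
  refine tsum_congr fun n => ?_
  rw [_root_.derivCoeff]
  push_cast
  ring

theorem hasSum_mul_of_hasSum_succ {B : ℕ → ℝ} (h0 : B 0 = 0) {x s : ℝ}
    (h : HasSum (fun n => B (n + 1) * x ^ n) s) : HasSum (fun n => B n * x ^ n) (x * s) := by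
  rw [← hasSum_nat_add_iff' 1]
  simp only [Finset.range_one, Finset.sum_singleton, h0, zero_mul, sub_zero]
  have he : (fun n => B (n + 1) * x ^ (n + 1)) = fun n => x * (B (n + 1) * x ^ n) := by
    funext n
    ring
  rw [he]
  exact h.mul_left x

/-- The Taylor coefficients of `F(a,a;1;z)`. -/
noncomputable def diagCoeff (a : ℝ) (n : ℕ) : ℝ :=
  (ascPochhammer ℝ n).eval a * (ascPochhammer ℝ n).eval a /
    ((ascPochhammer ℝ n).eval 1 * (n.factorial : ℝ))

theorem diagCoeff_succ (a : ℝ) (n : ℕ) :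
    ((n : ℝ) + 1) ^ 2 * diagCoeff a (n + 1) = (a + n) ^ 2 * diagCoeff a n := by
  have h1 : (ascPochhammer ℝ n).eval 1 ≠ 0 := (ascPochhammer_pos n 1 one_pos).ne'
  have h2 : (n.factorial : ℝ) ≠ 0 := by positivity
  have h3 : (n : ℝ) + 1 ≠ 0 := by positivity
  have h4 : 1 + (n : ℝ) ≠ 0 := by positivity
  simp only [diagCoeff, ascPochhammer_succ_eval, Nat.factorial_succ]
  push_cast
  field_simp
  ring

theorem summableOnUnitDisc_diagCoeff (a : ℝ) : SummableOnUnitDisc (diagCoeff a) := by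
  intro r hr0 hr1
  obtain ⟨s, hrs, hs1⟩ := exists_between hr1
  refine summable_of_ratio_norm_eventually_le hs1 ?_
  have hlim : Tendsto (fun n : ℕ => ((a + n) / (n + 1)) ^ 2 * r) atTop (𝓝 (1 ^ 2 * r)) := by
    refine Tendsto.mul_const r (Tendsto.pow ?_ 2)
    have h := (tendsto_one_div_add_atTop_nhds_zero_nat (𝕜 := ℝ)).const_mul (a - 1)
    have h' := h.const_add 1
    rw [mul_zero, add_zero] at h'
    refine h'.congr fun n => ?_
    have h3 : (n : ℝ) + 1 ≠ 0 := by positivity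
    field_simp
    ring
  filter_upwards [hlim.eventually (gt_mem_nhds (by simpa using hrs))] with n hn
  have h3 : (n : ℝ) + 1 ≠ 0 := by positivity
  have hA : diagCoeff a (n + 1) = ((a + n) / (n + 1)) ^ 2 * diagCoeff a n := by
    have := diagCoeff_succ a n
    field_simp
    linarith
  rw [Real.norm_of_nonneg (by positivity), Real.norm_of_nonneg (by positivity), hA, abs_mul,
    abs_of_nonneg (by positivity : 0 ≤ ((a + n) / ((n : ℝ) + 1)) ^ 2)]
  calc _ = ((a + n) / ((n : ℝ) + 1)) ^ 2 * r * (|diagCoeff a n| * r ^ n) := by ring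
    _ ≤ s * (|diagCoeff a n| * r ^ n) := by gcongr

/-- The `k`-th derivative of `F(a,a;1;x)`, as a power series. -/
noncomputable def diagSeries (a : ℝ) (k : ℕ) (x : ℝ) : ℝ :=
  ∑' n, derivCoeff^[k] (diagCoeff a) n * x ^ n

theorem gaussHypergeometric_eq_diagSeries (a x : ℝ) :
    gaussHypergeometric a a 1 x = diagSeries a 0 x := rfl

theorem summableOnUnitDisc_iterate (a : ℝ) (k : ℕ) :
    SummableOnUnitDisc (derivCoeff^[k] (diagCoeff a)) := by
  induction k with
  | zero => exact summableOnUnitDisc_diagCoeff a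
  | succ k ih =>
    rw [Function.iterate_succ_apply']
    exact ih.derivCoeff

theorem hasDerivAt_diagSeries (a : ℝ) (k : ℕ) {x : ℝ} (hx : |x| < 1) :
    HasDerivAt (diagSeries a k) (diagSeries a (k + 1) x) x := by
  have := (summableOnUnitDisc_iterate a k).hasDerivAt_tsum hx
  rw [← Function.iterate_succ_apply' derivCoeff] at this
  exact this

theorem diagSeries_ode (a : ℝ) {x : ℝ} (hx : |x| < 1) :
    x * (1 - x) * diagSeries a 2 x + (1 - (2 * a + 1) * x) * diagSeries a 1 x
      - a ^ 2 * diagSeries a 0 x = 0 := by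
  set A := diagCoeff a with hAdef
  have h0 : HasSum (fun n => A n * x ^ n) (diagSeries a 0 x) :=
    ((summableOnUnitDisc_iterate a 0).summable hx).hasSum
  have h1 : HasSum (fun n : ℕ => (((n : ℝ) + 1) * A (n + 1)) * x ^ n) (diagSeries a 1 x) :=
    ((summableOnUnitDisc_iterate a 1).summable hx).hasSum
  have h2 : HasSum (fun n : ℕ => (((n : ℝ) + 1) * (((n + 1 : ℕ) + 1) * A (n + 2))) * x ^ n)
      (diagSeries a 2 x) :=
    ((summableOnUnitDisc_iterate a 2).summable hx).hasSum
  have k1 : HasSum (fun n : ℕ => ((n : ℝ) * A n) * x ^ n) (x * diagSeries a 1 x) := by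
    refine hasSum_mul_of_hasSum_succ (B := fun n => (n : ℝ) * A n) (by simp) ?_
    simpa using h1
  have k2 : HasSum (fun n : ℕ => ((n : ℝ) * ((n + 1) * A (n + 1))) * x ^ n)
      (x * diagSeries a 2 x) := by
    refine hasSum_mul_of_hasSum_succ (B := fun n => (n : ℝ) * ((n + 1) * A (n + 1))) (by simp) ?_
    simpa using h2
  have k3 : HasSum (fun n : ℕ => ((n : ℝ) * ((n - 1) * A n)) * x ^ n)
      (x * (x * diagSeries a 2 x)) := by
    refine hasSum_mul_of_hasSum_succ (B := fun n => (n : ℝ) * ((n - 1) * A n)) (by simp) ?_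
    have he : (fun n : ℕ => (((n + 1 : ℕ) : ℝ) * (((n + 1 : ℕ) - 1) * A (n + 1))) * x ^ n)
        = fun n : ℕ => ((n : ℝ) * ((n + 1) * A (n + 1))) * x ^ n := by
      funext n
      push_cast
      ring
    rw [he]
    exact k2
  have e1 := k2.add h1
  have e2 := (k3.add (k1.mul_left (2 * a + 1))).add (h0.mul_left (a ^ 2))
  have e3 : (fun n : ℕ => ((n : ℝ) * ((n + 1) * A (n + 1))) * x ^ n
      + (((n : ℝ) + 1) * A (n + 1)) * x ^ n)
      = fun n : ℕ => ((n : ℝ) * ((n - 1) * A n)) * x ^ n + (2 * a + 1) * (((n : ℝ) * A n) * x ^ n)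
        + a ^ 2 * (A n * x ^ n) := by
    funext n
    have := diagCoeff_succ a n
    rw [← hAdef] at this
    linear_combination x ^ n * this
  rw [e3] at e1
  linear_combination e1.unique e2

/-- The function `(1+x)^{-a} F(a,a;1;x/(1+x))`, which by Pfaff's transformation is
`F(a,1-a;1;-x)`. -/
noncomputable def pfaff (a x : ℝ) : ℝ := (1 + x) ^ (-a) * diagSeries a 0 (x / (1 + x))

/-- The first derivative of `pfaff a`. -/
noncomputable def pfaffDeriv (a x : ℝ) : ℝ :=
  (1 + x) ^ (-a) *
    (-a * diagSeries a 0 (x / (1 + x)) / (1 + x) + diagSeries a 1 (x / (1 + x)) / (1 + x) ^ 2)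

/-- The second derivative of `pfaff a`. -/
noncomputable def pfaffDerivTwo (a x : ℝ) : ℝ :=
  (1 + x) ^ (-a) *
    (a * (a + 1) * diagSeries a 0 (x / (1 + x)) / (1 + x) ^ 2
      - 2 * (a + 1) * diagSeries a 1 (x / (1 + x)) / (1 + x) ^ 3
      + diagSeries a 2 (x / (1 + x)) / (1 + x) ^ 4)

theorem abs_div_one_add_lt_one {x : ℝ} (hx : -(1 / 2) < x) : |x / (1 + x)| < 1 := by
  have h : 0 < 1 + x := by linarith
  rw [abs_div, abs_of_pos h, div_lt_one h, abs_lt]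
  constructor <;> linarith

theorem hasDerivAt_diagSeries_comp (a : ℝ) (k : ℕ) {x : ℝ} (hx : -(1 / 2) < x) :
    HasDerivAt (fun y => diagSeries a k (y / (1 + y)))
      (diagSeries a (k + 1) (x / (1 + x)) / (1 + x) ^ 2) x := by
  have h : 1 + x ≠ 0 := by linarith
  have h1 : HasDerivAt (fun y : ℝ => y / (1 + y)) (1 / (1 + x) ^ 2) x := by
    refine ((hasDerivAt_id x).div ((hasDerivAt_id x).const_add 1) h).congr_deriv ?_
    simp
  refine ((hasDerivAt_diagSeries a k (abs_div_one_add_lt_one hx)).comp x h1).congr_deriv ?_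
  ring

theorem hasDerivAt_one_add_rpow (a : ℝ) {x : ℝ} (hx : -(1 / 2) < x) :
    HasDerivAt (fun y : ℝ => (1 + y) ^ (-a)) ((1 + x) ^ (-a) * (-a / (1 + x))) x := by
  have h : 0 < 1 + x := by linarith
  refine (((hasDerivAt_id x).const_add 1).rpow_const (p := -a) (Or.inl h.ne')).congr_deriv ?_
  rw [id, Real.rpow_sub_one h.ne']
  ring

theorem hasDerivAt_pfaff (a : ℝ) {x : ℝ} (hx : -(1 / 2) < x) :
    HasDerivAt (pfaff a) (pfaffDeriv a x) x := by
  refine ((hasDerivAt_one_add_rpow a hx).mul (hasDerivAt_diagSeries_comp a 0 hx)).congr_deriv ?_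
  rw [pfaffDeriv]
  ring

theorem hasDerivAt_pfaffDeriv (a : ℝ) {x : ℝ} (hx : -(1 / 2) < x) :
    HasDerivAt (pfaffDeriv a) (pfaffDerivTwo a x) x := by
  have h : 1 + x ≠ 0 := by linarith
  have hd : HasDerivAt (fun y : ℝ => 1 + y) 1 x := (hasDerivAt_id x).const_add 1
  refine ((hasDerivAt_one_add_rpow a hx).mul
    ((((hasDerivAt_diagSeries_comp a 0 hx).const_mul (-a)).div hd h).add
      ((hasDerivAt_diagSeries_comp a 1 hx).div (hd.pow 2) (pow_ne_zero 2 h)))).congr_deriv ?_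
  simp only [pfaffDerivTwo, Pi.add_apply, Pi.div_apply, Pi.pow_apply]
  field_simp
  ring

theorem continuousOn_pfaffDerivTwo (a : ℝ) :
    ContinuousOn (pfaffDerivTwo a) (Ioi (-(1 / 2))) := by
  intro x hx
  have hx : -(1 / 2) < x := hx
  have h : 1 + x ≠ 0 := by linarith
  have hd : ContinuousAt (fun y : ℝ => 1 + y) x := by fun_prop
  have hk (k : ℕ) := (hasDerivAt_diagSeries_comp a k hx).continuousAt
  exact ((hasDerivAt_one_add_rpow a hx).continuousAt.mul
    ((((hk 0).const_mul _).div (hd.pow 2) (pow_ne_zero 2 h)).sub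
      (((hk 1).const_mul _).div (hd.pow 3) (pow_ne_zero 3 h)) |>.add
      ((hk 2).div (hd.pow 4) (pow_ne_zero 4 h)))).continuousWithinAt

theorem pfaff_ode (a : ℝ) {x : ℝ} (hx : -(1 / 2) < x) :
    x * (1 + x) * pfaffDerivTwo a x + (1 + 2 * x) * pfaffDeriv a x = -(a * (1 - a)) * pfaff a x := by
  have h : 1 + x ≠ 0 := by linarith
  have ode := diagSeries_ode a (abs_div_one_add_lt_one hx)
  simp only [pfaffDerivTwo, pfaffDeriv, pfaff]
  generalize diagSeries a 0 (x / (1 + x)) = f at *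
  generalize diagSeries a 1 (x / (1 + x)) = f1 at *
  generalize diagSeries a 2 (x / (1 + x)) = f2 at *
  generalize (1 + x) ^ (-a) = P
  rw [← sub_eq_zero]
  rw [← mul_zero (P / (1 + x)), ← ode]
  field_simp
  ring

theorem hasDerivAt_integral_comp_mul {g g' w : ℝ → ℝ} {c x₀ : ℝ} (hc : c < 0) (hx₀ : c < x₀)
    (hw : Continuous w) (hg : ∀ x, c < x → HasDerivAt g (g' x) x)
    (hg' : ContinuousOn g' (Ioi c)) :
    HasDerivAt (fun x => ∫ y in (-1 : ℝ)..1, w y * g (x * (1 - y ^ 2)))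
      (∫ y in (-1 : ℝ)..1, (w y * (1 - y ^ 2)) * g' (x₀ * (1 - y ^ 2))) x₀ := by
  have hmem {x y : ℝ} (hx : c < x) (hy : y ∈ Icc (-1 : ℝ) 1) : c < x * (1 - y ^ 2) := by
    have h0 : 0 ≤ 1 - y ^ 2 := by nlinarith [hy.1, hy.2]
    have h1 : 1 - y ^ 2 ≤ 1 := by nlinarith
    rcases le_or_gt 0 x with h | h
    · nlinarith [mul_nonneg h h0]
    · nlinarith
  have hcont {φ v : ℝ → ℝ} (hφ : ContinuousOn φ (Ioi c)) (hv : Continuous v) {x : ℝ}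
      (hx : c < x) : ContinuousOn (fun y => v y * φ (x * (1 - y ^ 2))) (Icc (-1) 1) :=
    hv.continuousOn.mul (hφ.comp (by fun_prop) fun y hy => hmem hx hy)
  have hgc : ContinuousOn g (Ioi c) := fun x hx => (hg x hx).continuousAt.continuousWithinAt
  have hI : Ι (-1 : ℝ) 1 ⊆ Icc (-1) 1 := by
    rw [uIoc_of_le (by norm_num)]
    exact Ioc_subset_Icc_self
  obtain ⟨l, hcl, hlx⟩ := exists_between hx₀
  have hK : Icc (min l 0) (max (x₀ + 1) 0) ⊆ Ioi c := fun x hx => (lt_min hcl hc).trans_le hx.1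
  obtain ⟨C, hC⟩ := isCompact_Icc.exists_bound_of_continuousOn (hg'.mono hK)
  have hs : Ioo l (x₀ + 1) ∈ 𝓝 x₀ := Ioo_mem_nhds hlx (by linarith)
  have hmeas {φ v : ℝ → ℝ} (hφ : ContinuousOn φ (Ioi c)) (hv : Continuous v) {x : ℝ}
      (hx : c < x) : AEStronglyMeasurable (fun y => v y * φ (x * (1 - y ^ 2)))
        (volume.restrict (Ι (-1 : ℝ) 1)) :=
    ((hcont hφ hv hx).mono hI).aestronglyMeasurable measurableSet_uIoc
  refine (intervalIntegral.hasDerivAt_integral_of_dominated_loc_of_deriv_le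
    (F' := fun x y => (w y * (1 - y ^ 2)) * g' (x * (1 - y ^ 2)))
    (bound := fun y => |w y * (1 - y ^ 2)| * C) hs ?_ ?_ ?_ ?_ ?_ ?_).2
  · filter_upwards [hs] with x hx using hmeas hgc hw (hcl.trans hx.1)
  · exact ContinuousOn.intervalIntegrable (by
      rw [uIcc_of_le (by norm_num)]
      exact hcont hgc hw hx₀)
  · exact hmeas hg' (by fun_prop) hx₀
  · refine ae_of_all _ fun y hy x hx => ?_
    rw [norm_mul, Real.norm_eq_abs]
    refine mul_le_mul_of_nonneg_left (hC _ ?_) (abs_nonneg _)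
    have hy := hI hy
    have h0 : 0 ≤ 1 - y ^ 2 := by nlinarith [hy.1, hy.2]
    have h1 : 1 - y ^ 2 ≤ 1 := by nlinarith
    constructor
    · rcases le_or_gt 0 x with h | h
      · exact (min_le_right _ _).trans (mul_nonneg h h0)
      · exact (min_le_left _ _).trans (by nlinarith [hx.1])
    · rcases le_or_gt 0 x with h | h
      · exact le_trans (by nlinarith [hx.2]) (le_max_left _ _)
      · exact le_trans (by nlinarith) (le_max_right _ _)
  · exact Continuous.intervalIntegrable (by fun_prop) _ _
  · refine ae_of_all _ fun y hy x hx => ?_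
    have := (hg _ (hmem (hcl.trans hx.1) (hI hy))).comp x
      ((hasDerivAt_id x).mul_const (1 - y ^ 2))
    refine (this.const_mul (w y)).congr_deriv ?_
    ring

theorem continuousOn_pfaff_weight {φ w : ℝ → ℝ} (hφ : ContinuousOn φ (Ioi (-(1 / 2))))
    (hw : Continuous w) {X : ℝ} (hX : 0 ≤ X) :
    ContinuousOn (fun y => w y * φ (X * (1 - y ^ 2))) (uIcc (-1) 1) := by
  rw [uIcc_of_le (by norm_num)]
  refine hw.continuousOn.mul (hφ.comp (by fun_prop) fun y hy => ?_)
  have h0 : 0 ≤ 1 - y ^ 2 := by nlinarith [hy.1, hy.2]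
  have := mul_nonneg hX h0
  show -(1 / 2) < X * (1 - y ^ 2)
  linarith

/-- `2 F(a,1-a;3/2;-X)`, as an integral of `pfaff a`. -/
noncomputable def pfaffMean (a X : ℝ) : ℝ := ∫ y in (-1 : ℝ)..1, pfaff a (X * (1 - y ^ 2))

/-- The first derivative of `pfaffMean a`. -/
noncomputable def pfaffMeanDeriv (a X : ℝ) : ℝ :=
  ∫ y in (-1 : ℝ)..1, (1 - y ^ 2) * pfaffDeriv a (X * (1 - y ^ 2))

/-- The second derivative of `pfaffMean a`. -/
noncomputable def pfaffMeanDerivTwo (a X : ℝ) : ℝ :=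
  ∫ y in (-1 : ℝ)..1, ((1 - y ^ 2) * (1 - y ^ 2)) * pfaffDerivTwo a (X * (1 - y ^ 2))

theorem continuousOn_pfaff (a : ℝ) : ContinuousOn (pfaff a) (Ioi (-(1 / 2))) :=
  fun _ hx => (hasDerivAt_pfaff a hx).continuousAt.continuousWithinAt

theorem continuousOn_pfaffDeriv (a : ℝ) : ContinuousOn (pfaffDeriv a) (Ioi (-(1 / 2))) :=
  fun _ hx => (hasDerivAt_pfaffDeriv a hx).continuousAt.continuousWithinAt

theorem hasDerivAt_pfaffMean (a : ℝ) {X : ℝ} (hX : 0 ≤ X) :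
    HasDerivAt (pfaffMean a) (pfaffMeanDeriv a X) X := by
  have := hasDerivAt_integral_comp_mul (c := -(1 / 2)) (x₀ := X) (w := fun _ => 1) (by norm_num)
    (by linarith) continuous_const (fun x hx => hasDerivAt_pfaff a hx) (continuousOn_pfaffDeriv a)
  simp only [one_mul] at this
  exact this

theorem hasDerivAt_pfaffMeanDeriv (a : ℝ) {X : ℝ} (hX : 0 ≤ X) :
    HasDerivAt (pfaffMeanDeriv a) (pfaffMeanDerivTwo a X) X :=
  hasDerivAt_integral_comp_mul (c := -(1 / 2)) (x₀ := X) (w := fun y => 1 - y ^ 2) (by norm_num)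
    (by linarith) (by fun_prop) (fun x hx => hasDerivAt_pfaffDeriv a hx)
    (continuousOn_pfaffDerivTwo a)

theorem pfaffMean_zero (a : ℝ) : pfaffMean a 0 = 2 := by
  have h : pfaff a 0 = 1 := by
    have h0 : diagSeries a 0 0 = 1 := by
      rw [diagSeries, tsum_eq_single 0 (fun n hn => by simp [hn])]
      simp [diagCoeff]
    simp [pfaff, h0]
  simp only [pfaffMean, zero_mul, h]
  norm_num

theorem pfaffMean_ode (a : ℝ) {X : ℝ} (hX : 0 ≤ X) :
    X * (1 + X) * pfaffMeanDerivTwo a X + (3 / 2 + 2 * X) * pfaffMeanDeriv a X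
      = -(a * (1 - a)) * pfaffMean a X := by
  have hdom {y : ℝ} (hy : y ∈ uIcc (-1 : ℝ) 1) : -(1 / 2) < X * (1 - y ^ 2) := by
    rw [uIcc_of_le (by norm_num)] at hy
    have h0 : 0 ≤ 1 - y ^ 2 := by nlinarith [hy.1, hy.2]
    have := mul_nonneg hX h0
    linarith
  have i2 := (continuousOn_pfaff_weight (w := fun y => (1 - y ^ 2) * (1 - y ^ 2))
    (continuousOn_pfaffDerivTwo a) (by fun_prop) hX).intervalIntegrable (μ := volume)
  have i1 := (continuousOn_pfaff_weight (w := fun y => 1 - y ^ 2)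
    (continuousOn_pfaffDeriv a) (by fun_prop) hX).intervalIntegrable (μ := volume)
  have i0 := (continuousOn_pfaff_weight (w := fun _ => 1)
    (continuousOn_pfaff a) (by fun_prop) hX).intervalIntegrable (μ := volume)
  simp only [one_mul] at i0
  have hint := ((i2.const_mul (X * (1 + X))).add (i1.const_mul (3 / 2 + 2 * X))).sub
    (i0.const_mul (-(a * (1 - a))))
  have hderiv : ∀ y ∈ uIcc (-1 : ℝ) 1,
      HasDerivAt (fun y => y * (1 - y ^ 2) / 2 * pfaffDeriv a (X * (1 - y ^ 2)))
        (X * (1 + X) * ((1 - y ^ 2) * (1 - y ^ 2) * pfaffDerivTwo a (X * (1 - y ^ 2)))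
          + (3 / 2 + 2 * X) * ((1 - y ^ 2) * pfaffDeriv a (X * (1 - y ^ 2)))
          - -(a * (1 - a)) * pfaff a (X * (1 - y ^ 2))) y := by
    intro y hy
    have hq : HasDerivAt (fun y : ℝ => 1 - y ^ 2) (-(2 * y)) y := by
      simpa using (hasDerivAt_pow 2 y).const_sub 1
    have h1 := (hasDerivAt_pfaffDeriv a (hdom hy)).comp y (hq.const_mul X)
    have h2 := (((hasDerivAt_id y).mul hq).div_const 2).mul h1
    refine (h2).congr_deriv ?_
    have ode := pfaff_ode a (hdom hy)
    simp only [Pi.mul_apply, id, Function.comp]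
    linear_combination -ode
  have key := intervalIntegral.integral_eq_sub_of_hasDerivAt hderiv hint
  rw [intervalIntegral.integral_sub ((i2.const_mul _).add (i1.const_mul _)) (i0.const_mul _),
    intervalIntegral.integral_add (i2.const_mul _) (i1.const_mul _)] at key
  simp only [intervalIntegral.integral_const_mul] at key
  simp only [pfaffMean, pfaffMeanDeriv, pfaffMeanDerivTwo]
  norm_num at key
  linear_combination key

theorem eq_sinh_of_hasDerivAt {J J' : ℝ → ℝ} {M : ℝ} (hM : M ≠ 0)
    (hJ : ∀ x, HasDerivAt J (J' x) x) (hJ' : ∀ x, HasDerivAt J' (M ^ 2 * J x) x)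
    (h0 : J 0 = 0) (h0' : J' 0 = 1) (x : ℝ) : J x = 1 / M * Real.sinh (M * x) := by
  have conserved (m : ℝ) (hm : m ^ 2 = M ^ 2) :
      (J' x + m * J x) * Real.exp (-(m * x)) = 1 := by
    have hd : ∀ y, HasDerivAt (fun y => (J' y + m * J y) * Real.exp (-(m * y))) 0 y := by
      intro y
      have he : HasDerivAt (fun y => Real.exp (-(m * y))) (Real.exp (-(m * y)) * -m) y := by
        have := ((hasDerivAt_id y).const_mul m).neg.exp
        simpa using this
      refine (((hJ' y).add ((hJ y).const_mul m)).mul he).congr_deriv ?_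
      simp only [Pi.add_apply]
      linear_combination -Real.exp (-(m * y)) * J y * hm
    have := is_const_of_deriv_eq_zero (fun y => (hd y).differentiableAt)
      (fun y => (hd y).deriv) x 0
    simpa [h0, h0'] using this
  have h1 := conserved M rfl
  have h2 := conserved (-M) (by ring)
  rw [Real.exp_neg, mul_inv_eq_one₀ (Real.exp_ne_zero _)] at h1
  rw [Real.exp_neg, mul_inv_eq_one₀ (Real.exp_ne_zero _), neg_mul, neg_mul] at h2
  rw [Real.sinh_eq, ← h1, ← h2]
  field_simp
  ring

theorem sinh_mul_pfaffMean {M : ℝ} (hM : M ≠ 0) (τ : ℝ) :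
    Real.sinh (τ / 2) * pfaffMean (1 / 2 - M) (Real.sinh (τ / 2) ^ 2)
      = 1 / M * Real.sinh (M * τ) := by
  have hS (x : ℝ) : HasDerivAt (fun x => Real.sinh (x / 2)) (Real.cosh (x / 2) * (1 / 2)) x :=
    ((hasDerivAt_id x).div_const 2).sinh
  have hC (x : ℝ) : HasDerivAt (fun x => Real.cosh (x / 2)) (Real.sinh (x / 2) * (1 / 2)) x :=
    ((hasDerivAt_id x).div_const 2).cosh
  have hH (x : ℝ) := (hasDerivAt_pfaffMean (1 / 2 - M) (sq_nonneg (Real.sinh (x / 2)))).comp x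
    ((hS x).pow 2)
  have hH' (x : ℝ) := (hasDerivAt_pfaffMeanDeriv (1 / 2 - M)
    (sq_nonneg (Real.sinh (x / 2)))).comp x ((hS x).pow 2)
  refine eq_sinh_of_hasDerivAt
    (J := fun x => Real.sinh (x / 2) * pfaffMean (1 / 2 - M) (Real.sinh (x / 2) ^ 2))
    (J' := fun x => 1 / 2 * (Real.cosh (x / 2) * pfaffMean (1 / 2 - M) (Real.sinh (x / 2) ^ 2))
      + Real.sinh (x / 2) ^ 2 * (Real.cosh (x / 2)
        * pfaffMeanDeriv (1 / 2 - M) (Real.sinh (x / 2) ^ 2)))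
    hM (fun x => ?_) (fun x => ?_) (by simp) (by simp [pfaffMean_zero]) τ
  · refine ((hS x).mul (hH x)).congr_deriv ?_
    simp only [Function.comp, Pi.pow_apply]
    push_cast
    ring
  · refine ((((hC x).mul (hH x)).const_mul (1 / 2)).add
      (((hS x).pow 2).mul ((hC x).mul (hH' x)))).congr_deriv ?_
    have ode := pfaffMean_ode (1 / 2 - M) (sq_nonneg (Real.sinh (x / 2)))
    have hcs := Real.cosh_sq (x / 2)
    simp only [Function.comp, Pi.pow_apply, Pi.mul_apply]
    generalize pfaffMean (1 / 2 - M) (Real.sinh (x / 2) ^ 2) = H at *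
    generalize pfaffMeanDeriv (1 / 2 - M) (Real.sinh (x / 2) ^ 2) = H1 at *
    generalize pfaffMeanDerivTwo (1 / 2 - M) (Real.sinh (x / 2) ^ 2) = H2 at *
    generalize Real.sinh (x / 2) = S at *
    generalize Real.cosh (x / 2) = C at *
    push_cast
    linear_combination S * ode + (3 / 2 * S * H1 + S ^ 3 * H2) * hcs

/-- Proposition 2.1(i): integral representation of `sinh(M(t-b))/M` via the
hypergeometric kernel of the de Sitter Klein-Gordon fundamental solution. -/
theorem stmt_8 (M b t : ℝ) (hM : 0 < M) (hb : 0 ≤ b) (hbt : b ≤ t) :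
    (1 / M) * Real.sinh (M * (t - b))
      = ∫ z in (-(Real.exp (-b) - Real.exp (-t)))..(Real.exp (-b) - Real.exp (-t)),
          (4 * Real.exp (-b - t)) ^ (-M) *
          ((Real.exp (-t) + Real.exp (-b)) ^ 2 - z ^ 2) ^ (-(1 / 2 : ℝ) + M) *
          gaussHypergeometric (1 / 2 - M) (1 / 2 - M) 1
            (((Real.exp (-b) - Real.exp (-t)) ^ 2 - z ^ 2) /
             ((Real.exp (-b) + Real.exp (-t)) ^ 2 - z ^ 2)) := by
  have hA := Real.exp_pos (-b)
  have hB := Real.exp_pos (-t)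
  have hprod : Real.exp (-b - t) = Real.exp (-b) * Real.exp (-t) := by
    rw [← Real.exp_add]
    ring_nf
  set q := 2 * Real.exp ((-b - t) / 2) with hq
  have hq0 : 0 < q := by positivity
  have hqq : 4 * Real.exp (-b - t) = q ^ 2 := by
    rw [hq, mul_pow, ← Real.exp_nat_mul]
    push_cast
    ring_nf
  have hsinh : Real.exp (-b) - Real.exp (-t) = q * Real.sinh ((t - b) / 2) := by
    rw [Real.sinh_eq, hq, mul_assoc, ← mul_div_assoc, mul_div_cancel₀ _ two_ne_zero, mul_sub,
      ← Real.exp_add, ← Real.exp_add]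
    ring_nf
  have hsum : (Real.exp (-b) + Real.exp (-t)) ^ 2 = (Real.exp (-b) - Real.exp (-t)) ^ 2 + q ^ 2 := by
    rw [← hqq, hprod]
    ring
  rw [← sinh_mul_pfaffMean hM.ne', add_comm (Real.exp (-t)), hsum, hqq, hsinh]
  set S := Real.sinh ((t - b) / 2)
  have hsub := intervalIntegral.mul_integral_comp_mul_left (a := -1) (b := 1) (c := q * S)
    (f := fun z => (q ^ 2) ^ (-M) * ((q * S) ^ 2 + q ^ 2 - z ^ 2) ^ (-(1 / 2 : ℝ) + M) *
          gaussHypergeometric (1 / 2 - M) (1 / 2 - M) 1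
            (((q * S) ^ 2 - z ^ 2) / ((q * S) ^ 2 + q ^ 2 - z ^ 2)))
  rw [mul_neg_one, mul_one] at hsub
  rw [← hsub, mul_comm q S, mul_assoc, ← intervalIntegral.integral_const_mul, pfaffMean]
  congr 1
  refine intervalIntegral.integral_congr fun y hy => ?_
  rw [uIcc_of_le (by norm_num)] at hy
  have hy0 : 0 ≤ 1 - y ^ 2 := by nlinarith [hy.1, hy.2]
  have hp : 0 < 1 + S ^ 2 * (1 - y ^ 2) := by
    have := mul_nonneg (sq_nonneg S) hy0
    linarith
  have hden : (S * q) ^ 2 + q ^ 2 - (S * q * y) ^ 2 = q ^ 2 * (1 + S ^ 2 * (1 - y ^ 2)) := by ring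
  have hnum : (S * q) ^ 2 - (S * q * y) ^ 2 = q ^ 2 * (S ^ 2 * (1 - y ^ 2)) := by ring
  have hpow : q * ((q ^ 2) ^ (-M) * (q ^ 2) ^ (-(1 / 2 : ℝ) + M)) = 1 := by
    rw [← Real.rpow_add (by positivity), neg_add_cancel_comm_assoc, Real.rpow_neg (by positivity),
      ← Real.sqrt_eq_rpow, Real.sqrt_sq hq0.le, mul_inv_cancel₀ hq0.ne']
  simp only [hden, hnum, mul_div_mul_left _ _ (pow_ne_zero 2 hq0.ne'),
    gaussHypergeometric_eq_diagSeries, pfaff, Real.mul_rpow (sq_nonneg q) hp.le]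
  rw [show -(1 / 2 - M) = -(1 / 2 : ℝ) + M by ring]
  linear_combination -(1 + S ^ 2 * (1 - y ^ 2)) ^ (-(1 / 2 : ℝ) + M)
    * diagSeries (1 / 2 - M) 0 (S ^ 2 * (1 - y ^ 2) / (1 + S ^ 2 * (1 - y ^ 2))) * hpow
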